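/- arXiv:2010.05154 — 5 statements merged into one kernel-verified Lean document; each statement's English description precedes it below -/
import Mathlib

section
/- Let E be a real finite-dimensional inner product space, let δ ∈ (0,1], λ > 0, m₀, m₁ ≥ 0, M₀, M₁ ≥ 0 with δ·m₀ + m₁ ≥ λ. Let F₀, f₁ : E → ℝ be three times continuously differentiable with D²F₀(x)(v,v) ≥ m₀‖v‖², D²f₁(x)(v,v) ≥ m₁‖v‖², ‖D³F₀(x)‖ ≤ M₀ and ‖D³f₁(x)‖ ≤ M₁ for all x, v ∈ E. Suppose β₀ is a critical point of F₀ (DF₀(β₀) = 0) and β₁ is a minimizer of the incremental objective G(β) = f₁(β) + (δ/2)·D²F₀(β₀)(β−β₀, β−β₀). Then, with F₁ := δ·F₀ + f₁ and γ := ‖β₁ − β₀‖, one has F₁(β₀) − F₁(β₁) ≥ (λ/2)·γ² − ((δ·M₀ + M₁)/6)·γ³. -/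
theorem iteratedDeriv_comp_add_smul {E F : Type*} [NormedAddCommGroup E] [NormedSpace ℝ E]
    [NormedAddCommGroup F] [NormedSpace ℝ F] {f : E → F} {n : ℕ} (hf : ContDiff ℝ n f)
    (x v : E) (t : ℝ) :
    iteratedDeriv n (fun s : ℝ => f (x + s • v)) t =
      iteratedFDeriv ℝ n f (x + t • v) fun _ => v := by
  have hshift : ContDiff ℝ n fun y => f (x + y) := hf.comp (contDiff_const.add contDiff_id)
  have h := (ContinuousLinearMap.toSpanSingleton ℝ v).iteratedFDeriv_comp_right hshift t le_rfl
  rw [iteratedFDeriv_comp_add_left] at h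
  rw [iteratedDeriv_eq_iteratedFDeriv]
  simpa [Function.comp_def] using congrArg (fun L => L fun _ => (1 : ℝ)) h

/-- **Taylor's theorem** along a segment, with the Lagrange form of the remainder. -/
theorem exists_eq_sum_iteratedFDeriv_add_remainder {E : Type*} [NormedAddCommGroup E]
    [NormedSpace ℝ E] {f : E → ℝ} {n : ℕ} (hf : ContDiff ℝ (n + 1) f) (x v : E) :
    ∃ t ∈ Set.Ioo (0 : ℝ) 1,
      f (x + v) = ∑ k ∈ Finset.range (n + 1), iteratedFDeriv ℝ k f x (fun _ => v) / k.factorial +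
        iteratedFDeriv ℝ (n + 1) f (x + t • v) (fun _ => v) / (n + 1).factorial := by
  have hg : ContDiff ℝ (n + 1) fun s : ℝ => f (x + s • v) := by fun_prop
  obtain ⟨t, ht, h⟩ :=
    taylor_mean_remainder_lagrange_iteratedDeriv (zero_ne_one (α := ℝ)) hg.contDiffOn
  rw [Set.uIoo_of_lt zero_lt_one] at ht
  refine ⟨t, ht, ?_⟩
  rw [iteratedDeriv_comp_add_smul (by exact_mod_cast hf), sub_eq_iff_eq_add'] at h
  rw [taylor_within_apply] at h
  simp only [one_smul, sub_zero, one_pow, mul_one] at h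
  rw [h]
  congr 1
  refine Finset.sum_congr rfl fun k hk => ?_
  have hkn : (k : WithTop ℕ∞) ≤ n + 1 := by
    exact_mod_cast (Finset.mem_range.mp hk).le
  rw [iteratedDerivWithin_eq_iteratedDeriv (uniqueDiffOn_uIcc zero_ne_one)
    (hg.of_le hkn).contDiffAt Set.left_mem_uIcc, iteratedDeriv_comp_add_smul (hf.of_le hkn)]
  simp [div_eq_inv_mul]

/-- Cubic upper bound from the second-order Taylor expansion at a critical point. -/
theorem le_of_norm_iteratedFDeriv_three_le {E : Type*} [NormedAddCommGroup E] [NormedSpace ℝ E]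
    {f : E → ℝ} (hf : ContDiff ℝ 3 f) {M : ℝ} (hM : ∀ x, ‖iteratedFDeriv ℝ 3 f x‖ ≤ M)
    {x : E} (hx : fderiv ℝ f x = 0) (v : E) :
    f (x + v) ≤ f x + iteratedFDeriv ℝ 2 f x ![v, v] / 2 + M / 6 * ‖v‖ ^ 3 := by
  obtain ⟨t, -, h⟩ := exists_eq_sum_iteratedFDeriv_add_remainder (n := 2)
    (by norm_num; exact hf) x v
  have hrem : iteratedFDeriv ℝ 3 f (x + t • v) (fun _ => v) ≤ M * ‖v‖ ^ 3 := by
    refine (Real.le_norm_self _).trans ?_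
    simpa using (iteratedFDeriv ℝ 3 f (x + t • v)).le_of_opNorm_le (hM _) fun _ => v
  simp only [Finset.sum_range_succ, Finset.sum_range_zero, iteratedFDeriv_zero_apply,
    iteratedFDeriv_one_apply, hx, zero_apply] at h
  norm_num [Nat.factorial] at h
  have hvec : ![v, v] = fun _ => v := by ext i; fin_cases i <;> rfl
  rw [hvec]
  linarith

/-- Quadratic lower bound for a strongly convex function, from a lower bound on its Hessian. -/
theorem add_fderiv_add_le_of_le_iteratedFDeriv_two {E : Type*} [NormedAddCommGroup E]
    [NormedSpace ℝ E] {f : E → ℝ} (hf : ContDiff ℝ 2 f) {m : ℝ}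
    (hm : ∀ x v : E, m * ‖v‖ ^ 2 ≤ iteratedFDeriv ℝ 2 f x ![v, v]) (x v : E) :
    f x + fderiv ℝ f x v + m / 2 * ‖v‖ ^ 2 ≤ f (x + v) := by
  obtain ⟨t, -, h⟩ := exists_eq_sum_iteratedFDeriv_add_remainder (n := 1)
    (by norm_num; exact hf) x v
  have hrem := hm (x + t • v) v
  have hvec : ![v, v] = fun _ => v := by ext i; fin_cases i <;> rfl
  rw [hvec] at hrem
  simp only [Finset.sum_range_succ, Finset.sum_range_zero, iteratedFDeriv_zero_apply,
    iteratedFDeriv_one_apply] at h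
  norm_num [Nat.factorial] at h
  linarith

/-- First-order condition, along the segment to `a`, at a minimizer of `f` plus a quadratic form
centred at `a`. -/
theorem fderiv_apply_sub_eq_of_forall_add_quadratic_le {E : Type*} [NormedAddCommGroup E]
    [NormedSpace ℝ E] {f : E → ℝ} {a b : E} (hf : DifferentiableAt ℝ f b)
    (B : ContinuousMultilinearMap ℝ (fun _ : Fin 2 => E) ℝ) (c : ℝ)
    (hmin : ∀ y, f b + c / 2 * B ![b - a, b - a] ≤ f y + c / 2 * B ![y - a, y - a]) :
    fderiv ℝ f b (a - b) = c * B ![b - a, b - a] := by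
  set q := B ![b - a, b - a] with hq
  have hB (t : ℝ) : B ![b + t • (a - b) - a, b + t • (a - b) - a] = (1 - t) ^ 2 * q := by
    have hvec : ![b + t • (a - b) - a, b + t • (a - b) - a] =
        fun i => (1 - t) • ![b - a, b - a] i := by
      ext i; fin_cases i <;> simp <;> module
    rw [hvec, B.map_smul_univ (fun _ => 1 - t)]
    simp [hq]
  have hline : HasDerivAt (fun t : ℝ => b + t • (a - b)) (a - b) 0 := by
    simpa using ((hasDerivAt_id (0 : ℝ)).smul_const (a - b)).const_add b
  have hcomp : HasDerivAt (fun t : ℝ => f (b + t • (a - b))) (fderiv ℝ f b (a - b)) 0 := by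
    refine HasFDerivAt.comp_hasDerivAt (0 : ℝ) ?_ hline
    simpa using hf.hasFDerivAt
  have hquad : HasDerivAt (fun t : ℝ => c / 2 * ((1 - t) ^ 2 * q)) (-(c * q)) 0 := by
    refine (((((hasDerivAt_id (0 : ℝ)).const_sub 1).pow 2).mul_const q).const_mul
      (c / 2)).congr_deriv ?_
    norm_num
    ring
  have hloc : IsLocalMin
      ((fun t : ℝ => f (b + t • (a - b))) + fun t : ℝ => c / 2 * ((1 - t) ^ 2 * q)) 0 := by
    refine Filter.Eventually.of_forall fun t => ?_
    have := hmin (b + t • (a - b))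
    rw [hB] at this
    simpa using this
  linarith [hloc.hasDerivAt_eq_zero (hcomp.add hquad)]


/-- Theorem 1 of "Lambda Learner": the first incremental update improves the
cumulative loss over the stale batch model, with explicit cubic remainder. -/
theorem lambda_learner_first_incremental_update
    {E : Type*} [NormedAddCommGroup E] [InnerProductSpace ℝ E] [FiniteDimensional ℝ E]
    (δ lam m₀ m₁ M₀ M₁ : ℝ)
    (hδ : δ ∈ Set.Ioc (0 : ℝ) 1) (hlam : 0 < lam)
    (hm₀ : 0 ≤ m₀) (hm₁ : 0 ≤ m₁) (hM₀ : 0 ≤ M₀) (hM₁ : 0 ≤ M₁)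
    (hstrong : lam ≤ δ * m₀ + m₁)
    (F₀ f₁ : E → ℝ)
    (hF₀ : ContDiff ℝ 3 F₀) (hf₁ : ContDiff ℝ 3 f₁)
    (hHessF₀ : ∀ x v : E, m₀ * ‖v‖ ^ 2 ≤ iteratedFDeriv ℝ 2 F₀ x ![v, v])
    (hHessf₁ : ∀ x v : E, m₁ * ‖v‖ ^ 2 ≤ iteratedFDeriv ℝ 2 f₁ x ![v, v])
    (hD3F₀ : ∀ x : E, ‖iteratedFDeriv ℝ 3 F₀ x‖ ≤ M₀)
    (hD3f₁ : ∀ x : E, ‖iteratedFDeriv ℝ 3 f₁ x‖ ≤ M₁)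
    (β₀ β₁ : E)
    (hcrit : fderiv ℝ F₀ β₀ = 0)
    (hmin : ∀ β : E,
      f₁ β₁ + (δ / 2) * iteratedFDeriv ℝ 2 F₀ β₀ ![β₁ - β₀, β₁ - β₀] ≤
      f₁ β + (δ / 2) * iteratedFDeriv ℝ 2 F₀ β₀ ![β - β₀, β - β₀]) :
    (δ * F₀ β₀ + f₁ β₀) - (δ * F₀ β₁ + f₁ β₁) ≥
      (lam / 2) * ‖β₁ - β₀‖ ^ 2 - ((δ * M₀ + M₁) / 6) * ‖β₁ - β₀‖ ^ 3 := by
  have hexp := le_of_norm_iteratedFDeriv_three_le hF₀ hD3F₀ hcrit (β₁ - β₀)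
  have hconv := add_fderiv_add_le_of_le_iteratedFDeriv_two (hf₁.of_le (by norm_num)) hHessf₁
    β₁ (β₀ - β₁)
  rw [fderiv_apply_sub_eq_of_forall_add_quadratic_le (hf₁.differentiable (by norm_num) β₁)
    _ δ hmin, norm_sub_rev] at hconv
  rw [add_sub_cancel] at hexp hconv
  have hHess := mul_le_mul_of_nonneg_left (hHessF₀ β₀ (β₁ - β₀)) hδ.1.le
  have hexpδ := mul_le_mul_of_nonneg_left hexp hδ.1.le
  have hlamγ := mul_le_mul_of_nonneg_right hstrong (sq_nonneg ‖β₁ - β₀‖)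
  have hcubic := mul_nonneg hM₁ (pow_nonneg (norm_nonneg (β₁ - β₀)) 3)
  linarith
end

section
/- Let E be a real finite-dimensional inner product space, let δ ∈ (0,1], λ > 0, m₀, m₁ ≥ 0, M₀, M₁ ≥ 0 with δ·m₀ + m₁ ≥ λ. Let F₀, f₁ : E → ℝ be three times continuously differentiable with D²F₀(x)(v,v) ≥ m₀‖v‖², D²f₁(x)(v,v) ≥ m₁‖v‖², ‖D³F₀(x)‖ ≤ M₀ and ‖D³f₁(x)‖ ≤ M₁ for all x, v ∈ E. Suppose β₀ is a critical point of F₀ (DF₀(β₀) = 0) and β₁ is a minimizer of the incremental objective G(β) = f₁(β) + (δ/2)·D²F₀(β₀)(β−β₀, β−β₀). If moreover β₁ ≠ β₀ and (δ·M₀ + M₁)·‖β₁ − β₀‖ < 3λ, then F₁(β₁) < F₁(β₀), where F₁ := δ·F₀ + f₁; that is, the incremental update strictly improves the cumulative loss. -/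
open Nat in
/-- Taylor's lower bound: a lower bound `C` on the `(n + 1)`-st directional derivative along the
segment from `x` to `x + y` bounds the remainder of order `n` below by `C / (n + 1)!`. -/
theorem ContDiff.sum_iteratedFDeriv_add_le_map_add
    {E : Type*} [NormedAddCommGroup E] [NormedSpace ℝ E] {f : E → ℝ} {n : ℕ} {x y : E} {C : ℝ}
    (hf : ContDiff ℝ (n + 1) f)
    (hC : ∀ t ∈ Set.Icc (0 : ℝ) 1, C ≤ iteratedFDeriv ℝ (n + 1) f (x + t • y) fun _ ↦ y) :
    ∑ k ∈ Finset.range (n + 1), (k ! : ℝ)⁻¹ * (iteratedFDeriv ℝ k f x fun _ ↦ y) +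
      C / (n + 1)! ≤ f (x + y) := by
  rw [map_add_eq_sum_add_integral_iteratedFDeriv (n := n) fun t _ ↦ hf.contDiffAt]
  simp only [smul_eq_mul]
  gcongr
  have hcont : Continuous fun t : ℝ ↦ iteratedFDeriv ℝ (n + 1) f (x + t • y) fun _ ↦ y := by
    have h := hf.continuous_iteratedFDeriv (m := n + 1) (by norm_cast)
    exact (h.comp (g := iteratedFDeriv ℝ (n + 1) f)
      (f := fun t : ℝ ↦ x + t • y) (by fun_prop)).eval_const _
  have hint : ∫ t in (0 : ℝ)..1, (1 - t) ^ n * C = C / (n + 1) := by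
    rw [intervalIntegral.integral_mul_const,
      intervalIntegral.integral_comp_sub_left (fun t : ℝ ↦ t ^ n) 1]
    simp [div_eq_inv_mul]
  calc C / (n + 1)! = (n ! : ℝ)⁻¹ * ∫ t in (0 : ℝ)..1, (1 - t) ^ n * C := by
        rw [hint, Nat.factorial_succ]
        push_cast
        field_simp
    _ ≤ _ := by
        gcongr
        refine intervalIntegral.integral_mono_on zero_le_one
          (Continuous.intervalIntegrable (by fun_prop) _ _)
          (Continuous.intervalIntegrable (by fun_prop) _ _) fun t ht ↦ ?_
        exact mul_le_mul_of_nonneg_left (hC t ht) (pow_nonneg (sub_nonneg.2 ht.2) n)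

open Nat in
/-- Taylor's upper bound: an upper bound `C` on the `(n + 1)`-st directional derivative along the
segment from `x` to `x + y` bounds the remainder of order `n` above by `C / (n + 1)!`. -/
theorem ContDiff.map_add_le_sum_iteratedFDeriv_add
    {E : Type*} [NormedAddCommGroup E] [NormedSpace ℝ E] {f : E → ℝ} {n : ℕ} {x y : E} {C : ℝ}
    (hf : ContDiff ℝ (n + 1) f)
    (hC : ∀ t ∈ Set.Icc (0 : ℝ) 1, iteratedFDeriv ℝ (n + 1) f (x + t • y) (fun _ ↦ y) ≤ C) :
    f (x + y) ≤ ∑ k ∈ Finset.range (n + 1), (k ! : ℝ)⁻¹ * (iteratedFDeriv ℝ k f x fun _ ↦ y) +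
      C / (n + 1)! := by
  have h := ContDiff.sum_iteratedFDeriv_add_le_map_add (f := -f) (n := n) (x := x) (y := y)
    (C := -C) hf.neg fun t ht ↦ by simpa [iteratedFDeriv_neg] using hC t ht
  simp only [iteratedFDeriv_neg, Pi.neg_apply, neg_apply, mul_neg,
    Finset.sum_neg_distrib, neg_div] at h
  linarith

/-- First-order optimality condition, along a direction `v`, of a function perturbed by a
quadratic. -/
theorem fderiv_apply_eq_neg_of_forall_le_add_sq
    {E : Type*} [NormedAddCommGroup E] [NormedSpace ℝ E] {f : E → ℝ} {x v : E} {c : ℝ}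
    (hf : DifferentiableAt ℝ f x)
    (hmin : ∀ t : ℝ, f x + c / 2 ≤ f (x + t • v) + c / 2 * (1 + t) ^ 2) :
    fderiv ℝ f x v = -c := by
  have hline : HasDerivAt (fun t : ℝ ↦ f (x + t • v)) (fderiv ℝ f x v) 0 :=
    hf.hasFDerivAt.hasLineDerivAt v
  have hquad : HasDerivAt (fun t : ℝ ↦ c / 2 * (1 + t) ^ 2) c 0 := by
    have h := (((hasDerivAt_id (0 : ℝ)).const_add 1).pow 2).const_mul (c / 2)
    exact h.congr_deriv (by simp)
  have hloc : IsLocalMin (fun t : ℝ ↦ f (x + t • v) + c / 2 * (1 + t) ^ 2) 0 :=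
    Filter.Eventually.of_forall fun t ↦ by simpa using hmin t
  linarith [hloc.hasDerivAt_eq_zero (hline.add hquad)]


/-- Strict-improvement form of Theorem 1 of "Lambda Learner": under a smallness
condition on the step, the first incremental update strictly improves the
cumulative loss over the stale batch model. -/
theorem lambda_learner_first_incremental_update_strict
    {E : Type*} [NormedAddCommGroup E] [InnerProductSpace ℝ E] [FiniteDimensional ℝ E]
    (δ lam m₀ m₁ M₀ M₁ : ℝ)
    (hδ : δ ∈ Set.Ioc (0 : ℝ) 1) (hlam : 0 < lam)
    (hm₀ : 0 ≤ m₀) (hm₁ : 0 ≤ m₁) (hM₀ : 0 ≤ M₀) (hM₁ : 0 ≤ M₁)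
    (hstrong : lam ≤ δ * m₀ + m₁)
    (F₀ f₁ : E → ℝ)
    (hF₀ : ContDiff ℝ 3 F₀) (hf₁ : ContDiff ℝ 3 f₁)
    (hHessF₀ : ∀ x v : E, m₀ * ‖v‖ ^ 2 ≤ iteratedFDeriv ℝ 2 F₀ x ![v, v])
    (hHessf₁ : ∀ x v : E, m₁ * ‖v‖ ^ 2 ≤ iteratedFDeriv ℝ 2 f₁ x ![v, v])
    (hD3F₀ : ∀ x : E, ‖iteratedFDeriv ℝ 3 F₀ x‖ ≤ M₀)
    (hD3f₁ : ∀ x : E, ‖iteratedFDeriv ℝ 3 f₁ x‖ ≤ M₁)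
    (β₀ β₁ : E)
    (hcrit : fderiv ℝ F₀ β₀ = 0)
    (hmin : ∀ β : E,
      f₁ β₁ + (δ / 2) * iteratedFDeriv ℝ 2 F₀ β₀ ![β₁ - β₀, β₁ - β₀] ≤
      f₁ β + (δ / 2) * iteratedFDeriv ℝ 2 F₀ β₀ ![β - β₀, β - β₀])
    (hne : β₁ ≠ β₀)
    (hsmall : (δ * M₀ + M₁) * ‖β₁ - β₀‖ < 3 * lam) :
    δ * F₀ β₁ + f₁ β₁ < δ * F₀ β₀ + f₁ β₀ := by
  obtain ⟨r, rfl⟩ : ∃ r, β₁ = β₀ + r := ⟨β₁ - β₀, by abel⟩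
  have hpair (v : E) : ![v, v] = fun _ ↦ v := by ext i; fin_cases i <;> rfl
  simp only [hpair, add_sub_cancel_left] at hHessF₀ hHessf₁ hmin hsmall
  have hr : 0 < ‖r‖ := norm_pos_iff.2 (by simpa using hne)
  set a := iteratedFDeriv ℝ 2 F₀ β₀ fun _ ↦ r with ha
  have hopt : fderiv ℝ f₁ (β₀ + r) r = -(δ * a) := by
    refine fderiv_apply_eq_neg_of_forall_le_add_sq
      (hf₁.differentiable (by norm_num)).differentiableAt fun t ↦ ?_
    have h := hmin (β₀ + r + t • r)
    have hsub : β₀ + r + t • r - β₀ = (1 + t) • r := by module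
    have hsq : (iteratedFDeriv ℝ 2 F₀ β₀ fun _ ↦ (1 + t) • r) = (1 + t) ^ 2 * a := by
      rw [ContinuousMultilinearMap.map_smul_univ _ (fun _ ↦ 1 + t) fun _ ↦ r]
      simp [ha]
    rw [hsub, hsq] at h
    linarith
  have hf₁low : f₁ (β₀ + r) + δ * a + m₁ * ‖r‖ ^ 2 / 2 ≤ f₁ β₀ := by
    have h := (hf₁.of_le (by norm_num)).sum_iteratedFDeriv_add_le_map_add (n := 1)
      (x := β₀ + r) (y := -r) (C := m₁ * ‖r‖ ^ 2)
      fun t _ ↦ by simpa using hHessf₁ (β₀ + r + t • -r) (-r)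
    simpa [Finset.sum_range_succ, hopt] using h
  have hF₀up : F₀ (β₀ + r) ≤ F₀ β₀ + a / 2 + M₀ * ‖r‖ ^ 3 / 6 := by
    have h := hF₀.map_add_le_sum_iteratedFDeriv_add (n := 2) (x := β₀) (y := r)
      (C := M₀ * ‖r‖ ^ 3) fun t _ ↦ (le_abs_self _).trans <|
        (ContinuousMultilinearMap.le_of_opNorm_le (hD3F₀ _) _).trans_eq (by simp)
    simpa [Finset.sum_range_succ, hcrit, Nat.factorial, ← ha, div_eq_inv_mul] using h
  have hcurv : lam * ‖r‖ ^ 2 ≤ δ * a + m₁ * ‖r‖ ^ 2 := by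
    have h₁ := mul_le_mul_of_nonneg_left (hHessF₀ β₀ r) hδ.1.le
    have h₂ := mul_le_mul_of_nonneg_right hstrong (sq_nonneg ‖r‖)
    linarith
  have hcubic : δ * M₀ * ‖r‖ ^ 3 < 3 * lam * ‖r‖ ^ 2 := by
    have h₁ : δ * M₀ * ‖r‖ < 3 * lam := by nlinarith [mul_nonneg hM₁ hr.le]
    nlinarith [mul_lt_mul_of_pos_right h₁ (pow_pos hr 2)]
  linarith [mul_le_mul_of_nonneg_left hF₀up hδ.1.le]
end

section
/- Let E be a real finite-dimensional inner product space, δ ∈ (0,1], M₀, M₁ ≥ 0, and let F₀, f₁ : E → ℝ be three times continuously differentiable with ‖D³F₀(x)‖ ≤ M₀ and ‖D³f₁(x)‖ ≤ M₁ for all x ∈ E. Suppose β₀ is a critical point of F₀ (DF₀(β₀) = 0) and β₁ is a minimizer of the incremental objective G(β) = f₁(β) + (δ/2)·D²F₀(β₀)(β−β₀, β−β₀). Then, with F₁ := δ·F₀ + f₁ and A denoting the bilinear form δ·D²F₀(β₀) + D²f₁(β₁), one has |F₁(β₀) − F₁(β₁) − (1/2)·A(β₁−β₀, β₁−β₀)|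 ≤ ((δ·M₀ + M₁)/6)·‖β₁ − β₀‖³. -/
/-- Second-order Taylor expansion of a `C³` function on a normed space, with the explicit cubic
remainder coming from a uniform bound on the third derivative. -/
theorem abs_map_add_sub_taylor_two_le {E : Type*} [NormedAddCommGroup E] [NormedSpace ℝ E]
    {f : E → ℝ} {M : ℝ} (hf : ContDiff ℝ 3 f) (hM : ∀ x, ‖iteratedFDeriv ℝ 3 f x‖ ≤ M)
    (x y : E) :
    |f (x + y) - (f x + fderiv ℝ f x y + (1 / 2) * iteratedFDeriv ℝ 2 f x ![y, y])| ≤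
      M / 6 * ‖y‖ ^ 3 := by
  have taylor := map_add_eq_sum_add_integral_iteratedFDeriv (f := f) (x := x) (y := y) (n := 2)
    fun t _ => by exact_mod_cast hf.contDiffAt
  have hconst : (fun _ : Fin 2 => y) = ![y, y] := by
    ext i; fin_cases i <;> rfl
  simp only [Finset.sum_range_succ, Finset.sum_range_zero, iteratedFDeriv_zero_apply,
    iteratedFDeriv_one_apply, hconst, Nat.factorial, smul_eq_mul] at taylor
  norm_num at taylor
  have hint : ∫ t in (0 : ℝ)..1, (1 - t) ^ 2 * (M * ‖y‖ ^ 3) = M * ‖y‖ ^ 3 / 3 := by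
    rw [intervalIntegral.integral_mul_const,
      intervalIntegral.integral_comp_sub_left (fun t : ℝ => t ^ 2) 1]
    norm_num [integral_pow]
    ring
  have bound : |∫ t in (0 : ℝ)..1, (1 - t) ^ 2 * iteratedFDeriv ℝ 3 f (x + t • y) (fun _ => y)| ≤
      M * ‖y‖ ^ 3 / 3 := by
    rw [← hint, ← Real.norm_eq_abs]
    refine intervalIntegral.norm_integral_le_of_norm_le zero_le_one
      (Filter.Eventually.of_forall fun t _ => ?_)
      (Continuous.intervalIntegrable (by fun_prop) _ _)
    rw [norm_mul, Real.norm_of_nonneg (sq_nonneg (1 - t))]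
    gcongr
    refine (ContinuousMultilinearMap.le_opNorm _ _).trans ?_
    simp only [Finset.prod_const, Finset.card_univ, Fintype.card_fin]
    gcongr
    exact hM _
  rw [abs_le] at bound ⊢
  constructor <;> linarith [bound.1, bound.2]

/-- Scaling a diagonal argument of a bilinear form. -/
theorem ContinuousMultilinearMap.map_smul_diag_two {E : Type*} [NormedAddCommGroup E]
    [NormedSpace ℝ E] (B : ContinuousMultilinearMap ℝ (fun _ : Fin 2 => E) ℝ) (c : ℝ) (y : E) :
    B ![c • y, c • y] = c ^ 2 * B ![y, y] := by
  have h := B.map_smul_univ (fun _ => c) ![y, y]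
  have hv : (fun i => c • (![y, y] : Fin 2 → E) i) = ![c • y, c • y] := by
    ext i; fin_cases i <;> rfl
  simpa [hv] using h

/-- Stationarity, along the radial direction `x - x₀`, of a minimizer `x` of a differentiable
function plus a quadratic form centred at `x₀`. -/
theorem fderiv_radial_add_quadratic_eq_zero {E : Type*} [NormedAddCommGroup E]
    [NormedSpace ℝ E] {f : E → ℝ} {B : ContinuousMultilinearMap ℝ (fun _ : Fin 2 => E) ℝ}
    {c : ℝ} {x₀ x : E} (hf : DifferentiableAt ℝ f x)
    (hmin : ∀ z, f x + (c / 2) * B ![x - x₀, x - x₀] ≤ f z + (c / 2) * B ![z - x₀, z - x₀]) :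
    fderiv ℝ f x (x - x₀) + c * B ![x - x₀, x - x₀] = 0 := by
  set y := x - x₀ with hy
  have hline : HasDerivAt (fun t : ℝ => x + t • y) y 0 := by
    simpa using ((hasDerivAt_id (0 : ℝ)).smul_const y).const_add x
  have hfline : HasDerivAt (fun t : ℝ => f (x + t • y)) (fderiv ℝ f x y) 0 := by
    refine HasFDerivAt.comp_hasDerivAt (0 : ℝ) ?_ hline
    simpa using hf.hasFDerivAt
  have hquad : HasDerivAt (fun t : ℝ => (c / 2) * ((1 + t) ^ 2 * B ![y, y])) (c * B ![y, y]) 0 := by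
    refine HasDerivAt.congr_deriv (((((hasDerivAt_id (0 : ℝ)).const_add 1).pow 2).mul_const
      (B ![y, y])).const_mul (c / 2)) ?_
    simp only [id]
    ring
  refine IsLocalMin.hasDerivAt_eq_zero (Filter.Eventually.of_forall fun t => ?_)
    (hfline.add hquad)
  have h := hmin (x + t • y)
  have hshift : x + t • y - x₀ = (1 + t) • y := by
    rw [add_smul, one_smul, hy]; abel
  rw [hshift, B.map_smul_diag_two] at h
  simpa using h


/-- Equation (pf5) of "Lambda Learner": the improvement of the first incremental
update equals half the squared step in the Hessian norm of the incremental
objective, up to an explicit cubic Taylor remainder. -/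
theorem lambda_learner_pf5
    {E : Type*} [NormedAddCommGroup E] [InnerProductSpace ℝ E] [FiniteDimensional ℝ E]
    (δ M₀ M₁ : ℝ)
    (hδ : δ ∈ Set.Ioc (0 : ℝ) 1) (hM₀ : 0 ≤ M₀) (hM₁ : 0 ≤ M₁)
    (F₀ f₁ : E → ℝ)
    (hF₀ : ContDiff ℝ 3 F₀) (hf₁ : ContDiff ℝ 3 f₁)
    (hD3F₀ : ∀ x : E, ‖iteratedFDeriv ℝ 3 F₀ x‖ ≤ M₀)
    (hD3f₁ : ∀ x : E, ‖iteratedFDeriv ℝ 3 f₁ x‖ ≤ M₁)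
    (β₀ β₁ : E)
    (hcrit : fderiv ℝ F₀ β₀ = 0)
    (hmin : ∀ β : E,
      f₁ β₁ + (δ / 2) * iteratedFDeriv ℝ 2 F₀ β₀ ![β₁ - β₀, β₁ - β₀] ≤
      f₁ β + (δ / 2) * iteratedFDeriv ℝ 2 F₀ β₀ ![β - β₀, β - β₀]) :
    |((δ * F₀ β₀ + f₁ β₀) - (δ * F₀ β₁ + f₁ β₁)) -
        (1 / 2) * (δ * iteratedFDeriv ℝ 2 F₀ β₀ ![β₁ - β₀, β₁ - β₀] +
          iteratedFDeriv ℝ 2 f₁ β₁ ![β₁ - β₀, β₁ - β₀])| ≤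
      ((δ * M₀ + M₁) / 6) * ‖β₁ - β₀‖ ^ 3 := by
  have hstat := fderiv_radial_add_quadratic_eq_zero
    (hf₁.differentiable (by norm_num)).differentiableAt hmin
  have taylor₀ := abs_map_add_sub_taylor_two_le hF₀ hD3F₀ β₀ (β₁ - β₀)
  have taylor₁ := abs_map_add_sub_taylor_two_le hf₁ hD3f₁ β₁ (-(β₁ - β₀))
  have hneg := (iteratedFDeriv ℝ 2 f₁ β₁).map_smul_diag_two (-1) (β₁ - β₀)
  simp only [neg_one_smul] at hneg
  rw [hcrit, add_sub_cancel] at taylor₀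
  rw [hneg, norm_neg, map_neg, ← sub_eq_add_neg, sub_sub_cancel] at taylor₁
  simp only [zero_apply] at taylor₀
  rw [abs_le] at taylor₀ taylor₁ ⊢
  have lower := mul_le_mul_of_nonneg_left taylor₀.1 hδ.1.le
  have upper := mul_le_mul_of_nonneg_left taylor₀.2 hδ.1.le
  constructor <;> linarith [taylor₁.1, taylor₁.2]
end

section
/- Let E be a real inner product space, δ ∈ ℝ, t ≥ 1 a natural number, β₀, …, β_t ∈ E points, A₀, …, A_{t−1} : E → E continuous linear operators, and g₁, …, g_t ∈ E vectors satisfying, for each 1 ≤ k ≤ t, g_k = −δ·(Σ_{j=0}^{k−1} δ^{k−1−j}·A_j)(β_k − β_{k−1}). Then for every w ∈ E: Σ_{k=1}^{t} δ^{t−k}·⟨g_k, w⟩ = −Σ_{j=0}^{t−1} δ^{t−j}·⟨A_j(β_t − β_j), w⟩. -/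
open RealInnerProductSpace

/-- The telescoping identity of equations (pf24)–(pf24b) of "Lambda Learner":
substituting the first-order optimality conditions, swapping summations and
telescoping yields
`Σ_{k=1}^{t} δ^{t−k}⟪g_k, w⟫ = −Σ_{j=0}^{t−1} δ^{t−j}⟪A_j(β_t − β_j), w⟫`. -/
theorem lambda_learner_telescoping_identity
    {E : Type*} [NormedAddCommGroup E] [InnerProductSpace ℝ E]
    (δ : ℝ) (t : ℕ) (ht : 1 ≤ t)
    (β : ℕ → E) (A : ℕ → E →L[ℝ] E) (g : ℕ → E)
    (hg : ∀ k, 1 ≤ k → k ≤ t →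
      g k = -δ • ∑ j ∈ Finset.range k, δ ^ (k - 1 - j) • A j (β k - β (k - 1))) :
    ∀ w : E,
      ∑ k ∈ Finset.Icc 1 t, δ ^ (t - k) * ⟪g k, w⟫ =
        -∑ j ∈ Finset.range t, δ ^ (t - j) * ⟪A j (β t - β j), w⟫ := by
  intro w
  clear ht
  induction t with
  | zero => simp
  | succ n ih =>
    have ih' := ih fun k h1 hk => hg k h1 (hk.trans n.le_succ)
    have hdiscount : ∑ k ∈ Finset.Icc 1 n, δ ^ (n + 1 - k) * ⟪g k, w⟫ =
        δ * ∑ k ∈ Finset.Icc 1 n, δ ^ (n - k) * ⟪g k, w⟫ := by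
      rw [Finset.mul_sum]
      refine Finset.sum_congr rfl fun k hk => ?_
      rw [Nat.succ_sub (Finset.mem_Icc.mp hk).2, pow_succ]
      ring
    have hlast : ⟪g (n + 1), w⟫ =
        -∑ j ∈ Finset.range (n + 1), δ ^ (n + 1 - j) * ⟪A j (β (n + 1) - β n), w⟫ := by
      rw [hg (n + 1) (by omega) le_rfl, real_inner_smul_left, sum_inner, neg_mul,
        Finset.mul_sum]
      congr 1
      refine Finset.sum_congr rfl fun j hj => ?_
      rw [real_inner_smul_left, Nat.add_sub_cancel,
        Nat.succ_sub (Finset.mem_range_succ_iff.mp hj), pow_succ]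
      ring
    have hprev : δ * ∑ j ∈ Finset.range n, δ ^ (n - j) * ⟪A j (β n - β j), w⟫ =
        ∑ j ∈ Finset.range (n + 1), δ ^ (n + 1 - j) * ⟪A j (β n - β j), w⟫ := by
      rw [Finset.sum_range_succ, sub_self, map_zero, inner_zero_left, mul_zero, add_zero,
        Finset.mul_sum]
      refine Finset.sum_congr rfl fun j hj => ?_
      rw [Nat.succ_sub (Finset.mem_range.mp hj).le, pow_succ]
      ring
    rw [Finset.sum_Icc_succ_top (by omega), hdiscount, ih', mul_neg, hprev, Nat.sub_self,
      pow_zero, one_mul, hlast, ← neg_add, ← Finset.sum_add_distrib]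
    congr 1
    refine Finset.sum_congr rfl fun j _ => ?_
    rw [← mul_add, ← inner_add_left, ← map_add, sub_add_sub_cancel']
end

section
/- Let E be a real inner product space, δ ∈ ℝ, t ≥ 1 a natural number, β₀, …, β_t ∈ E points, A₀, …, A_t : E → E continuous self-adjoint linear operators, g₀ := 0, and g₁, …, g_t ∈ E vectors satisfying, for each 1 ≤ k ≤ t, g_k = −δ·(Σ_{j=0}^{k−1} δ^{k−1−j}·A_j)(β_k − β_{k−1}). Then Σ_{k=0}^{t} δ^{t−k}·[ ⟨g_k, β₀ − β_t⟩ + (1/2)·⟨β₀ − β_k, A_k(β₀ − β_k)⟩ − (1/2)·⟨β_t − β_k, A_k(β_t − β_k)⟩ ] = (1/2)·Σ_{k=0}^{t} δ^{t−k}·⟨β₀ − β_t, A_k(β₀ − β_t)⟩. -/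
open RealInnerProductSpace

/-- A discounted sum up to `n + 1` is `δ` times the discounted sum up to `n`, plus the last term. -/
theorem sum_range_succ_discount {M : Type*} [AddCommGroup M] [Module ℝ M]
    (δ : ℝ) (f : ℕ → M) (n : ℕ) :
    ∑ k ∈ Finset.range (n + 1 + 1), δ ^ (n + 1 - k) • f k =
      δ • ∑ k ∈ Finset.range (n + 1), δ ^ (n - k) • f k + f (n + 1) := by
  rw [Finset.sum_range_succ, Finset.smul_sum]
  congr 1
  · refine Finset.sum_congr rfl fun k hk => ?_
    rw [smul_smul, ← pow_succ', Nat.succ_sub (Finset.mem_range_succ_iff.mp hk)]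
  · simp

/-- Telescoping of the discounted gradients: the optimality conditions give
`∑ δ ^ (n - k) • g k = -∑ δ ^ (n - k) • A k (β n - β k)`. -/
theorem sum_discount_gradient {E : Type*} [NormedAddCommGroup E] [NormedSpace ℝ E]
    (δ : ℝ) (t : ℕ) (β : ℕ → E) (A : ℕ → E →L[ℝ] E) (g : ℕ → E) (hg0 : g 0 = 0)
    (hg : ∀ k, 1 ≤ k → k ≤ t →
      g k = -δ • ∑ j ∈ Finset.range k, δ ^ (k - 1 - j) • A j (β k - β (k - 1)))
    (n : ℕ) (hn : n ≤ t) :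
    ∑ k ∈ Finset.range (n + 1), δ ^ (n - k) • g k =
      -∑ k ∈ Finset.range (n + 1), δ ^ (n - k) • A k (β n - β k) := by
  induction n with
  | zero => simp [hg0]
  | succ n ih =>
    rw [sum_range_succ_discount, sum_range_succ_discount δ (fun k => A k (β (n + 1) - β k)),
      ih (by omega), hg (n + 1) (by omega) hn]
    simp only [Nat.add_sub_cancel, sub_self, map_zero, add_zero, smul_neg, neg_smul,
      ← neg_add, ← smul_add, ← Finset.sum_add_distrib, ← map_add, sub_add_sub_cancel']

/-- The exact algebraic core of equation (pf25) of "Lambda Learner": grouping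
the quadratic Taylor terms by the Hessians `A_k` shows the improvement equals
`(1/2)·Σ_k δ^{t−k}‖β₀ − β_t‖²_{A_k}`. -/
theorem lambda_learner_pf25_algebraic_core
    {E : Type*} [NormedAddCommGroup E] [InnerProductSpace ℝ E]
    (δ : ℝ) (t : ℕ) (ht : 1 ≤ t)
    (β : ℕ → E) (A : ℕ → E →L[ℝ] E)
    (hA : ∀ k, ∀ u v : E, ⟪A k u, v⟫ = ⟪u, A k v⟫)
    (g : ℕ → E) (hg0 : g 0 = 0)
    (hg : ∀ k, 1 ≤ k → k ≤ t →
      g k = -δ • ∑ j ∈ Finset.range k, δ ^ (k - 1 - j) • A j (β k - β (k - 1))) :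
    ∑ k ∈ Finset.range (t + 1), δ ^ (t - k) *
        (⟪g k, β 0 - β t⟫ + (1 / 2) * ⟪β 0 - β k, A k (β 0 - β k)⟫ -
          (1 / 2) * ⟪β t - β k, A k (β t - β k)⟫) =
      (1 / 2) * ∑ k ∈ Finset.range (t + 1), δ ^ (t - k) * ⟪β 0 - β t, A k (β 0 - β t)⟫ := by
  have key := congrArg (fun x => ⟪x, β 0 - β t⟫) (sum_discount_gradient δ t β A g hg0 hg t le_rfl)
  simp only [inner_neg_left, sum_inner, real_inner_smul_left] at key
  rw [← sub_eq_zero, Finset.mul_sum, ← Finset.sum_sub_distrib]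
  rw [eq_neg_iff_add_eq_zero, ← Finset.sum_add_distrib] at key
  rw [← key]
  refine Finset.sum_congr rfl fun k _ => ?_
  have h : β 0 - β k = (β 0 - β t) + (β t - β k) := by abel
  have hs := hA k (β t - β k) (β 0 - β t)
  rw [h, map_add, inner_add_left, inner_add_right, inner_add_right, ← hs,
    real_inner_comm (A k (β t - β k)) (β 0 - β t)]
  ring
end
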